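/- arXiv:1902.02439 — 6 statements merged into one kernel-verified Lean document; each statement's English description precedes it below -/
import Mathlib

section
/- Let S be the SR-automaton for a parsing table (A, la) of a context-free grammar G, with initial state P_init. If, for some local resolution of possible conflicts, the parsing of a word w on (A, la) is successful and returns the reduction stack tree(w), then there exists a state-stack Γ such that (ε, [P_init], ε, []) ⇒* (ε, Γ, w$, tree(w)) in the execution relation of S. -/
set_option autoImplicit false

namespace SR

/-- A production of a context-free grammar: a nonterminal left-hand side and a
right-hand side over `N ⊕ T` (nonterminals and terminals). -/
structure Prod' (N T : Type) where
  lhs : N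
  rhs : List (N ⊕ T)

/-- A context-free grammar with nonterminals `N`, terminals `T`. -/
structure CFG (N T : Type) where
  start : N
  prods : Set (Prod' N T)

variable {Q N T : Type}

/-- A rightmost derivation step: rewrite the rightmost nonterminal. -/
inductive RMStep (G : CFG N T) : List (N ⊕ T) → Prod' N T → List (N ⊕ T) → Prop
  | step (γ : List (N ⊕ T)) (w : List T) (p : Prod' N T) (hp : p ∈ G.prods) :
      RMStep G (γ ++ Sum.inl p.lhs :: w.map Sum.inr) p (γ ++ p.rhs ++ w.map Sum.inr)

/-- A rightmost derivation from `α` to `γ` using the list of productions `ps`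
(in order of application, i.e. from top to bottom of the reduction stack). -/
inductive RMDeriv (G : CFG N T) : List (N ⊕ T) → List (Prod' N T) → List (N ⊕ T) → Prop
  | nil (α : List (N ⊕ T)) : RMDeriv G α [] α
  | cons {α β γ : List (N ⊕ T)} {p : Prod' N T} {ps : List (Prod' N T)} :
      RMStep G α p β → RMDeriv G β ps γ → RMDeriv G α (p :: ps) γ

/-- The language generated by `G`. -/
def CFG.lang (G : CFG N T) : Set (List T) :=
  { w | ∃ ps, RMDeriv G [Sum.inl G.start] ps (w.map Sum.inr) }

/-- `G` is ambiguous iff some word of `L(G)` has two distinct rightmost derivations. -/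
def CFG.Ambiguous (G : CFG N T) : Prop :=
  ∃ (w : List T) (ps₁ ps₂ : List (Prod' N T)),
    RMDeriv G [Sum.inl G.start] ps₁ (w.map Sum.inr) ∧
    RMDeriv G [Sum.inl G.start] ps₂ (w.map Sum.inr) ∧ ps₁ ≠ ps₂

/-- A parsing table `(A, la)`: the characteristic automaton `A` is given by its
(partial, deterministic) transition function `tau` over the vocabulary
`V ∪ {$}` (the endmarker `$` is `Sum.inr none`), an initial and a final state;
`la` is the lookahead function. -/
structure Table (Q N T : Type) where
  tau : Q → (N ⊕ Option T) → Option Q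
  init : Q
  final : Q
  la : Prod' N T → Q → Set (Option T)

/-- Embed a grammar symbol into the vocabulary `V ∪ {$}`. -/
def liftSym : (N ⊕ T) → (N ⊕ Option T) := Sum.map id some

/-- There is a path spelling `β` in the characteristic automaton from `R` to `P`. -/
inductive PathSpells (M : Table Q N T) : Q → List (N ⊕ T) → Q → Prop
  | nil (P : Q) : PathSpells M P [] P
  | cons {P P' R : Q} {s : N ⊕ T} {β : List (N ⊕ T)} :
      M.tau P (liftSym s) = some P' → PathSpells M P' β R →
      PathSpells M P (s :: β) R

/-- `τ_SR(P, [x]:R:p) = Q'`: the reduce transition of the SR-automaton,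
labelled by the prospective symbol `[x]`, the state `R` and the production `p`. -/
def ReduceTrans (M : Table Q N T) (P : Q) (x : Option T) (R : Q) (p : Prod' N T)
    (Q' : Q) : Prop :=
  x ∈ M.la p P ∧ PathSpells M R p.rhs P ∧ M.tau R (Sum.inl p.lhs) = some Q'

/-- A configuration `(h, Γ, z, Δ)` of an SR-automaton: `head = none` is `ε`,
`head = some x` is the prospective symbol `[x]`; `states` is the state-stack
(top of stack = head of list), `word` the word-component (over `T ∪ {$}`,
with `$ = none`), `prods` the production-stack (top = head). -/
structure Config (Q N T : Type) where
  head : Option (Option T)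
  states : List Q
  word : List (Option T)
  prods : List (Prod' N T)

/-- Labels of execution steps: rule (S) with symbol `x`, or rule (R) with the
transition data `[x]:R:p`. -/
inductive SRLabel (Q N T : Type)
  | shift (x : Option T)
  | reduce (x : Option T) (R : Q) (p : Prod' N T)

/-- The labelled execution relation of the SR-automaton for `M`. -/
inductive ExecL (M : Table Q N T) : SRLabel Q N T → Config Q N T → Config Q N T → Prop
  | shift {h : Option (Option T)} {P : Q} {Γ : List Q} {w : List (Option T)}
      {Δ : List (Prod' N T)} {x : Option T} {Q' : Q} :
      M.tau P (Sum.inr x) = some Q' → (h = none ∨ h = some x) →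
      ExecL M (.shift x) ⟨h, P :: Γ, w, Δ⟩ ⟨none, Q' :: P :: Γ, w ++ [x], Δ⟩
  | reduce {h : Option (Option T)} {P : Q} {Γ Γ' : List Q} {w : List (Option T)}
      {Δ : List (Prod' N T)} {x : Option T} {R : Q} {p : Prod' N T} {Q' : Q} :
      ReduceTrans M P x R p Q' →
      Γ' = (P :: Γ).drop p.rhs.length →
      Γ'.head? = some R →
      (h = none ∨ h = some x) →
      ExecL M (.reduce x R p) ⟨h, P :: Γ, w, Δ⟩ ⟨some x, Q' :: Γ', w, p :: Δ⟩

/-- The execution relation `⇒` of the SR-automaton for `M`. -/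
def Exec (M : Table Q N T) (c c' : Config Q N T) : Prop := ∃ l, ExecL M l c c'

/-- `⇒*`, the reflexive-transitive closure of the execution relation. -/
def ExecStar (M : Table Q N T) : Config Q N T → Config Q N T → Prop :=
  Relation.ReflTransGen (Exec M)

/-- The initial configuration `(ε, [P_init], ε, [])`. -/
def initConfig (M : Table Q N T) : Config Q N T := ⟨none, [M.init], [], []⟩

/-- `w$` as a string over `T ∪ {$}`. -/
def endWord (w : List T) : List (Option T) := w.map some ++ [none]

/-- The language accepted by the SR-automaton for `M`. -/
def SRLang (M : Table Q N T) : Set (List T) :=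
  { w | ∃ (Γ : List Q) (Δ : List (Prod' N T)),
      ExecStar M (initConfig M) ⟨none, Γ, endWord w, Δ⟩ }

/-- A configuration of the shift-reduce algorithm: the stack of traversed
states (top = head), the remaining input, and the stack of performed
reductions (top = head). -/
structure PConfig (Q N T : Type) where
  states : List Q
  input : List (Option T)
  prods : List (Prod' N T)

/-- One move of the (nondeterministic) shift-reduce algorithm driven by the
controller `(A, la)`: a conflict is resolved by a local choice among the
directives of the current table entry. -/
inductive PStep (M : Table Q N T) : PConfig Q N T → PConfig Q N T → Prop
  | shift {P : Q} {Γ : List Q} {x : Option T} {rest : List (Option T)}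
      {Δ : List (Prod' N T)} {Q' : Q} :
      M.tau P (Sum.inr x) = some Q' →
      PStep M ⟨P :: Γ, x :: rest, Δ⟩ ⟨Q' :: P :: Γ, rest, Δ⟩
  | reduce {P : Q} {Γ Γ' : List Q} {x : Option T} {rest : List (Option T)}
      {Δ : List (Prod' N T)} {R : Q} {p : Prod' N T} {Q' : Q} :
      ReduceTrans M P x R p Q' →
      Γ' = (P :: Γ).drop p.rhs.length →
      Γ'.head? = some R →
      PStep M ⟨P :: Γ, x :: rest, Δ⟩ ⟨Q' :: Γ', x :: rest, p :: Δ⟩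

/-- The parsing of `w` on `(A, la)` is successful, for some local resolution of
possible conflicts, and returns the reduction stack `Δ` (`tree(w)`). -/
def ParseSuccess (M : Table Q N T) (w : List T) (Δ : List (Prod' N T)) : Prop :=
  ∃ Γ, Relation.ReflTransGen (PStep M) ⟨[M.init], endWord w, []⟩ ⟨Γ, [], Δ⟩

/-- The table entry `(P, x)` contains a shift directive. -/
def ShiftDir (M : Table Q N T) (P : Q) (x : Option T) : Prop :=
  ∃ Q', M.tau P (Sum.inr x) = some Q'

/-- The table entry `(P, x)` contains a reduce directive for production `p`. -/
def ReduceDir (M : Table Q N T) (P : Q) (x : Option T) (p : Prod' N T) : Prop :=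
  ∃ R Q', ReduceTrans M P x R p Q'

/-- The state `P` has a conflict on `x`: the table entry `(P, x)` is multiply
defined (s/r or r/r conflict). -/
def HasConflict (M : Table Q N T) (P : Q) (x : Option T) : Prop :=
  (ShiftDir M P x ∧ ∃ p, ReduceDir M P x p) ∨
  (∃ p p', p ≠ p' ∧ ReduceDir M P x p ∧ ReduceDir M P x p')

/-- The two execution steps `ν ⇒ ν'` and `ν ⇒ ν''` are in conflict on `x`. -/
def InConflictOn (M : Table Q N T) (x : Option T) (ν ν' ν'' : Config Q N T) : Prop :=
  (∃ P, ν.states.head? = some P ∧ HasConflict M P x) ∧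
  ((∃ R' p' R'' p'', p' ≠ p'' ∧
      ExecL M (.reduce x R' p') ν ν' ∧ ExecL M (.reduce x R'' p'') ν ν'') ∨
   (ExecL M (.shift x) ν ν' ∧ ∃ R p, ExecL M (.reduce x R p) ν ν'') ∨
   (ExecL M (.shift x) ν ν'' ∧ ∃ R p, ExecL M (.reduce x R p) ν ν'))

/-- `(A, la)` is a correct controller for `G`: a word is in `L(G)` iff for some
local resolution of conflicts its parsing is successful, and when parsing
succeeds the reduction stack lists, from top to bottom, the productions of a
rightmost derivation of the word in `G`. -/
def CorrectController (M : Table Q N T) (G : CFG N T) : Prop :=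
  (∀ w : List T, w ∈ G.lang ↔ ∃ Δ, ParseSuccess M w Δ) ∧
  (∀ (w : List T) (Δ : List (Prod' N T)), ParseSuccess M w Δ →
      RMDeriv G [Sum.inl G.start] Δ (w.map Sum.inr))

/-- The approximation relation `P →x Q'`. -/
def ShiftRel (M : Table Q N T) (x : Option T) (P Q' : Q) : Prop :=
  M.tau P (Sum.inr x) = some Q'

/-- The approximation relation `P →[x] Q'`. -/
def ProspRel (M : Table Q N T) (x : Option T) (P Q' : Q) : Prop :=
  ∃ R p, ReduceTrans M P x R p Q'

/-- `P ⇛x Q'` stands for `P (→[x])* →x Q'`. -/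
def DArrow (M : Table Q N T) (x : Option T) (P Q' : Q) : Prop :=
  ∃ P'', Relation.ReflTransGen (ProspRel M x) P P'' ∧ ShiftRel M x P'' Q'

/-- `P ⇛w Q'` for a word `w = x₁…x_j`. -/
def DArrowWord (M : Table Q N T) : List (Option T) → Q → Q → Prop
  | [], P, Q' => P = Q'
  | x :: z, P, Q' => ∃ P'', DArrow M x P P'' ∧ DArrowWord M z P'' Q'

/-- A chain of execution steps together with the list of its labels. -/
inductive LSteps (M : Table Q N T) : Config Q N T → List (SRLabel Q N T) → Config Q N T → Prop
  | nil (c : Config Q N T) : LSteps M c [] c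
  | cons {c c' c'' : Config Q N T} {l : SRLabel Q N T} {ls : List (SRLabel Q N T)} :
      ExecL M l c c' → LSteps M c' ls c'' → LSteps M c (l :: ls) c''

end SR

namespace SR

/-- The SR-automaton simulates the shift-reduce algorithm: the word-component is the consumed part
of the input, and a pending prospective symbol is the next input symbol. -/
theorem exists_execStar_of_parse {Q N T : Type} {M : Table Q N T} {v : List (Option T)}
    {c : PConfig Q N T} (hc : Relation.ReflTransGen (PStep M) ⟨[M.init], v, []⟩ c) :
    ∃ h z, ExecStar M (initConfig M) ⟨h, c.states, z, c.prods⟩ ∧ z ++ c.input = v ∧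
      ∀ y, h = some y → c.input.head? = some y := by
  induction hc with
  | refl => exact ⟨none, [], .refl, rfl, by simp⟩
  | tail _ hstep ih =>
    obtain ⟨h, z, hexec, hz, hh⟩ := ih
    cases hstep with
    | @shift P Γ x rest Δ Q' htau =>
      have hx : h = none ∨ h = some x := by cases h <;> simp_all
      exact ⟨none, z ++ [x], hexec.tail ⟨_, .shift htau hx⟩, by simpa using hz, by simp⟩
    | @reduce P Γ Γ' x rest Δ R p Q' htr hΓ hR =>
      have hx : h = none ∨ h = some x := by cases h <;> simp_all
      exact ⟨some x, z, hexec.tail ⟨_, .reduce htr hΓ hR hx⟩, hz, by simp⟩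

end SR

open SR in
/-- If, for some local resolution of possible conflicts, the
parsing of `w` on `(A, la)` is successful and returns `tree(w) = Δ`, then there
is a state-stack `Γ` with `(ε, [P_init], ε, []) ⇒* (ε, Γ, w$, Δ)` in the
execution relation of the SR-automaton for `(A, la)`. -/
theorem sr_exec_of_parse {Q N T : Type} (M : Table Q N T)
    (w : List T) (Δ : List (Prod' N T)) (hparse : ParseSuccess M w Δ) :
    ∃ Γ : List Q, ExecStar M (initConfig M) ⟨none, Γ, endWord w, Δ⟩ := by
  obtain ⟨Γ, hΓ⟩ := hparse
  obtain ⟨h, z, hexec, hz, hh⟩ := exists_execStar_of_parse hΓ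
  obtain rfl : h = none := by cases h <;> simp_all
  obtain rfl : z = endWord w := by simpa using hz
  exact ⟨Γ, hexec⟩
end

section
/- Let S be the SR-automaton for a parsing table (A, la) of a context-free grammar G, with initial state P_init. If, for some state-stack Γ and some production-stack Δ, (ε, [P_init], ε, []) ⇒* (ε, Γ, w$, Δ) in the execution relation of S, then, for some local resolution of possible conflicts, the parsing of w on (A, la) is successful and tree(w) = Δ. -/
set_option autoImplicit false

open SR in
/-- Along an execution ending with an empty head, the shift-reduce algorithm can simulate the
steps on the part of the word still to be read, and the head predicts the next symbol read. -/
theorem SR.ExecStar.exists_parse {Q N T : Type} {M : Table Q N T} {c : Config Q N T}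
    {Γ : List Q} {z : List (Option T)} {Δ : List (Prod' N T)}
    (h : ExecStar M c ⟨none, Γ, z, Δ⟩) :
    ∃ rest, z = c.word ++ rest ∧ (∀ x, c.head = some x → rest.head? = some x) ∧
      Relation.ReflTransGen (PStep M) ⟨c.states, rest, c.prods⟩ ⟨Γ, [], Δ⟩ := by
  induction h using Relation.ReflTransGen.head_induction_on with
  | refl => exact ⟨[], by simp, by simp, .refl⟩
  | head hstep _ ih =>
    obtain ⟨l, hl⟩ := hstep
    obtain ⟨rest, hz, hhead, hparse⟩ := ih
    cases hl with
    | @shift h _ _ w _ x _ htau hh =>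
      refine ⟨x :: rest, by simpa using hz, ?_, .head (.shift htau) hparse⟩
      rintro y rfl
      simpa [eq_comm] using hh
    | @reduce h _ _ _ w _ x _ _ _ hred hdrop hR hh =>
      obtain ⟨rest', rfl⟩ := List.head?_eq_some_iff.mp (hhead x rfl)
      refine ⟨x :: rest', hz, ?_, .head (.reduce hred hdrop hR) hparse⟩
      rintro y rfl
      simpa [eq_comm] using hh

open SR in
/-- If `(ε, [P_init], ε, []) ⇒* (ε, Γ, w$, Δ)` in the
execution relation of the SR-automaton for `(A, la)`, then, for some local
resolution of possible conflicts, the parsing of `w` on `(A, la)` is successful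
and `tree(w) = Δ`. -/
theorem parse_of_sr_exec {Q N T : Type} (M : Table Q N T)
    (w : List T) (Γ : List Q) (Δ : List (Prod' N T))
    (hexec : ExecStar M (initConfig M) ⟨none, Γ, endWord w, Δ⟩) :
    ParseSuccess M w Δ := by
  obtain ⟨rest, hw, -, hparse⟩ := hexec.exists_parse
  obtain rfl : endWord w = rest := by simpa [initConfig] using hw
  exact ⟨Γ, hparse⟩
end

section
/- Let S be the SR-automaton for a parsing table (A, la) of a context-free grammar G, and assume (A, la) is a correct controller for G. Then the language accepted by the SR-automaton equals the language generated by the grammar: L(S) = L(G). -/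
set_option autoImplicit false

namespace SR

/-- An execution ending with empty head reads a word that starts with the prospective symbol
held in the initial head, and the shift-reduce algorithm can follow it on that word. -/
theorem ExecStar.exists_parse_s2 {Q N T : Type} {M : Table Q N T} {c : Config Q N T}
    {Γ : List Q} {z : List (Option T)} {Δ : List (Prod' N T)}
    (h : ExecStar M c ⟨none, Γ, z, Δ⟩) :
    ∃ u, z = c.word ++ u ∧ (∀ x, c.head = some x → u.head? = some x) ∧
      Relation.ReflTransGen (PStep M) ⟨c.states, u, c.prods⟩ ⟨Γ, [], Δ⟩ := by
  induction h using Relation.ReflTransGen.head_induction_on with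
  | refl => exact ⟨[], by simp, by simp, .refl⟩
  | head hstep _ ih =>
    obtain ⟨u, hz, hu, hsteps⟩ := ih
    obtain ⟨l, hl⟩ := hstep
    cases hl with
    | @shift _ _ _ _ _ x _ htau hh =>
      refine ⟨x :: u, by simpa using hz, ?_, .head (.shift htau) hsteps⟩
      rintro y rfl
      simpa [eq_comm] using hh
    | @reduce _ _ _ _ _ _ x _ _ _ hred hdrop htop hh =>
      have hx := hu x rfl
      cases u with
      | nil => simp at hx
      | cons y rest =>
        obtain rfl : y = x := by simpa using hx
        refine ⟨y :: rest, hz, ?_, .head (.reduce hred hdrop htop) hsteps⟩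
        rintro v rfl
        simpa [eq_comm] using hh

/-- The SR-automaton can follow any run of the shift-reduce algorithm that consumes its input,
from a head compatible with the first input symbol. -/
theorem execStar_of_parse {Q N T : Type} {M : Table Q N T} {c : PConfig Q N T}
    {Γ : List Q} {Δ : List (Prod' N T)}
    (h : Relation.ReflTransGen (PStep M) c ⟨Γ, [], Δ⟩)
    (hd : Option (Option T)) (z : List (Option T))
    (hhd : ∀ x, hd = some x → c.input.head? = some x) :
    ExecStar M ⟨hd, c.states, z, c.prods⟩ ⟨none, Γ, z ++ c.input, Δ⟩ := by
  induction h using Relation.ReflTransGen.head_induction_on generalizing hd z with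
  | refl =>
    cases hd with
    | none => simpa [ExecStar] using Relation.ReflTransGen.refl
    | some x => simpa using hhd x rfl
  | head hstep _ ih =>
    have compat {x : Option T} {rest : List (Option T)}
        (hx : ∀ y, hd = some y → (x :: rest).head? = some y) : hd = none ∨ hd = some x := by
      cases hd with
      | none => exact .inl rfl
      | some y => exact .inr (hx y rfl).symm
    cases hstep with
    | @shift _ _ x _ _ _ htau =>
      refine .head ⟨_, .shift htau (compat hhd)⟩ ?_
      simpa [ExecStar] using ih none (z ++ [x]) (by simp)
    | @reduce _ _ _ x _ _ _ _ _ hred hdrop htop =>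
      refine .head ⟨_, .reduce hred hdrop htop (compat hhd)⟩ ?_
      exact ih (some x) z (by simp)

/-- The SR-automaton accepts exactly the words that the shift-reduce algorithm parses. -/
theorem mem_srLang_iff {Q N T : Type} (M : Table Q N T) (w : List T) :
    w ∈ SRLang M ↔ ∃ Δ, ParseSuccess M w Δ := by
  constructor
  · rintro ⟨Γ, Δ, h⟩
    obtain ⟨u, hu, -, hsteps⟩ := h.exists_parse_s2
    obtain rfl : endWord w = u := hu
    exact ⟨Δ, Γ, hsteps⟩
  · rintro ⟨Δ, Γ, h⟩
    exact ⟨Γ, Δ, execStar_of_parse h none [] (by simp)⟩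

end SR

open SR in
/-- If `(A, la)` is a correct controller for `G`, then the
language accepted by the SR-automaton for `(A, la)` equals `L(G)`. -/
theorem srLang_eq_lang {Q N T : Type} (M : Table Q N T) (G : CFG N T)
    (hcorrect : CorrectController M G) :
    SRLang M = G.lang := by
  ext w
  exact (mem_srLang_iff M w).trans (hcorrect.1 w).symm
end

section
/- Let S be an SR-automaton with initial state P_init. If (ε, [P_init], ε, []) ⇒* (ε, Γ₁, w$, Δ₁) and (ε, [P_init], ε, []) ⇒* (ε, Γ₂, w$, Δ₂) are two executions reaching configurations with the same word-component w$ but with Δ₁ ≠ Δ₂, then the two executions consist of zero or more identical initial steps up to a common configuration ν whose state-stack top P has a conflict on some symbol x, and from ν they continue with two distinct steps that are in conflict on x. -/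
set_option autoImplicit false

namespace SR

variable {Q N T : Type}

/-- The symbol of `T ∪ {$}` on which a step depends. -/
def SRLabel.sym : SRLabel Q N T → Option T
  | .shift x => x
  | .reduce x _ _ => x

theorem ExecStar.prospective_word {M : Table Q N T} {c d : Config Q N T}
    (h : ExecStar M c d) (hd : d.head = none) :
    c.word <+: d.word ∧ ∀ x, c.head = some x → c.word ++ [x] <+: d.word := by
  induction h using Relation.ReflTransGen.head_induction_on with
  | refl => exact ⟨List.prefix_rfl, fun x hx => by simp [hd] at hx⟩
  | head hs _ ih =>
    obtain ⟨_, hs⟩ := hs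
    cases hs with
    | shift ht hh =>
      refine ⟨(List.prefix_append _ _).trans ih.1, fun y hy => ?_⟩
      rcases hh with rfl | rfl
      · simp at hy
      · obtain rfl := Option.some.inj hy
        exact ih.1
    | reduce hr hΓ hR hh =>
      refine ⟨ih.1, fun y hy => ?_⟩
      rcases hh with rfl | rfl
      · simp at hy
      · exact ih.2 y hy

theorem ExecL.word_append_sym_prefix {M : Table Q N T} {l : SRLabel Q N T} {c c' d : Config Q N T}
    (hs : ExecL M l c c') (h : ExecStar M c' d) (hd : d.head = none) :
    c.word ++ [l.sym] <+: d.word := by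
  cases hs with
  | shift ht hh => exact (h.prospective_word hd).1
  | reduce hr hΓ hR hh => exact (h.prospective_word hd).2 _ rfl

/-- Two steps on the same symbol lead to the same configuration or are in conflict. -/
theorem ExecL.eq_or_inConflictOn {M : Table Q N T} {l₁ l₂ : SRLabel Q N T} {c c₁ c₂ : Config Q N T}
    (h₁ : ExecL M l₁ c c₁) (h₂ : ExecL M l₂ c c₂) (hl : l₁.sym = l₂.sym) :
    c₁ = c₂ ∨ InConflictOn M l₁.sym c c₁ c₂ := by
  have h₁' := h₁
  have h₂' := h₂
  cases h₁ with
  | shift t₁ hh₁ =>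
    cases h₂ with
    | shift t₂ hh₂ =>
      obtain rfl : _ = _ := hl
      obtain rfl := Option.some.inj (t₁.symm.trans t₂)
      exact .inl rfl
    | reduce r₂ hΓ₂ hR₂ hh₂ =>
      obtain rfl : _ = _ := hl
      exact .inr ⟨⟨_, rfl, .inl ⟨⟨_, t₁⟩, _, _, _, r₂⟩⟩, .inr (.inl ⟨h₁', _, _, h₂'⟩)⟩
  | @reduce _ _ _ _ _ _ _ _ p₁ _ r₁ hΓ₁ hR₁ hh₁ =>
    cases h₂ with
    | shift t₂ hh₂ =>
      obtain rfl : _ = _ := hl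
      exact .inr ⟨⟨_, rfl, .inl ⟨⟨_, t₂⟩, _, _, _, r₁⟩⟩, .inr (.inr ⟨h₂', _, _, h₁'⟩)⟩
    | @reduce _ _ _ _ _ _ _ _ p₂ _ r₂ hΓ₂ hR₂ hh₂ =>
      obtain rfl : _ = _ := hl
      by_cases hp : p₁ = p₂
      · subst hp hΓ₁ hΓ₂
        obtain rfl := Option.some.inj (hR₁.symm.trans hR₂)
        obtain rfl := Option.some.inj (r₁.2.2.symm.trans r₂.2.2)
        exact .inl rfl
      · exact .inr ⟨⟨_, rfl, .inr ⟨_, _, hp, ⟨_, _, r₁⟩, _, _, r₂⟩⟩,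
          .inl ⟨_, _, _, _, hp, h₁', h₂'⟩⟩

/-- An execution step cannot lead from a configuration to one with no prospective symbol and
the same word-component. -/
theorem ExecStar.eq_of_word_eq {M : Table Q N T} {c d : Config Q N T}
    (h : ExecStar M c d) (hd : d.head = none) (hw : c.word = d.word) : c = d := by
  rcases Relation.ReflTransGen.cases_head h with rfl | ⟨e, ⟨l, hs⟩, he⟩
  · rfl
  · have := (hs.word_append_sym_prefix he hd).length_le
    simp [hw] at this

theorem ExecStar.exists_inConflictOn {M : Table Q N T} {c d₁ d₂ : Config Q N T}
    (h₁ : ExecStar M c d₁) (h₂ : ExecStar M c d₂)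
    (hd₁ : d₁.head = none) (hd₂ : d₂.head = none) (hw : d₁.word = d₂.word) (hne : d₁ ≠ d₂) :
    ∃ x ν ν' ν'', ExecStar M c ν ∧ InConflictOn M x ν ν' ν'' ∧
      ExecStar M ν' d₁ ∧ ExecStar M ν'' d₂ := by
  induction h₁ using Relation.ReflTransGen.head_induction_on with
  | refl => exact absurd (h₂.eq_of_word_eq hd₂ hw) hne
  | @head c c₁ hs₁ hr₁ ih =>
    rcases Relation.ReflTransGen.cases_head h₂ with rfl | ⟨c₂, hs₂, hr₂⟩
    · exact absurd
        (ExecStar.eq_of_word_eq (Relation.ReflTransGen.head hs₁ hr₁) hd₁ hw.symm).symm hne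
    obtain ⟨l₁, hl₁⟩ := id hs₁
    obtain ⟨l₂, hl₂⟩ := hs₂
    have hp₁ := hl₁.word_append_sym_prefix hr₁ hd₁
    have hp₂ := hl₂.word_append_sym_prefix hr₂ hd₂
    have hl : l₁.sym = l₂.sym := by
      have := (List.prefix_of_prefix_length_le (hw ▸ hp₁) hp₂ (by simp)).eq_of_length (by simp)
      simpa using this
    rcases hl₁.eq_or_inConflictOn hl₂ hl with rfl | hc
    · obtain ⟨x, ν, ν', ν'', hν, h⟩ := ih hr₂
      exact ⟨x, ν, ν', ν'', Relation.ReflTransGen.head hs₁ hν, h⟩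
    · exact ⟨_, c, c₁, c₂, .refl, hc, hr₁, hr₂⟩

end SR

open SR in
/-- Two executions from the initial configuration reaching
configurations with the same word-component `w$` but distinct production-stacks
`Δ₁ ≠ Δ₂` consist of identical initial steps up to a common configuration `ν`
whose state-stack top has a conflict on some `x`, from which they continue with
two distinct steps in conflict on `x`. -/
theorem executions_diverge_at_conflict {Q N T : Type} (M : Table Q N T)
    (w : List T) (Γ₁ Γ₂ : List Q) (Δ₁ Δ₂ : List (Prod' N T))
    (h₁ : ExecStar M (initConfig M) ⟨none, Γ₁, endWord w, Δ₁⟩)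
    (h₂ : ExecStar M (initConfig M) ⟨none, Γ₂, endWord w, Δ₂⟩)
    (hne : Δ₁ ≠ Δ₂) :
    ∃ (x : Option T) (ν ν' ν'' : Config Q N T),
      ExecStar M (initConfig M) ν ∧
      InConflictOn M x ν ν' ν'' ∧
      ExecStar M ν' ⟨none, Γ₁, endWord w, Δ₁⟩ ∧
      ExecStar M ν'' ⟨none, Γ₂, endWord w, Δ₂⟩ := by
  exact h₁.exists_inConflictOn h₂ rfl rfl rfl fun h => hne (congrArg Config.prods h)
end

section
/- Let ν be a configuration of an SR-automaton and suppose ν ⇒ ν' and ν ⇒ ν'' are two execution steps both inferred by rule (R), depending on transitions τ_SR(P, [x]:R':p') and τ_SR(P, [x]:R'':p'') with distinct productions p' ≠ p''. Then for every pair of further executions ν' ⇒* μ₁ and ν'' ⇒* μ₂, the production-stacks of μ₁ and μ₂ are distinct. -/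
set_option autoImplicit false

namespace SR

/-- An execution step only ever pushes onto the production-stack. -/
theorem ExecL.prods_suffix {Q N T : Type} {M : Table Q N T} {l : SRLabel Q N T}
    {c c' : Config Q N T} (h : ExecL M l c c') : c.prods <:+ c'.prods := by
  cases h with
  | shift => exact List.suffix_rfl
  | reduce => exact List.suffix_cons _ _

theorem ExecStar.prods_suffix {Q N T : Type} {M : Table Q N T}
    {c c' : Config Q N T} (h : ExecStar M c c') : c.prods <:+ c'.prods := by
  induction h with
  | refl => exact List.suffix_rfl
  | tail _ hstep ih =>
    obtain ⟨_, hl⟩ := hstep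
    exact ih.trans hl.prods_suffix

end SR

open SR in
/-- If `ν ⇒ ν'` and `ν ⇒ ν''` are both inferred by rule (R),
depending on `τ_SR(P,[x]:R':p')` and `τ_SR(P,[x]:R'':p'')` with `p' ≠ p''`,
then for all further executions `ν' ⇒* μ₁` and `ν'' ⇒* μ₂` the
production-stacks of `μ₁` and `μ₂` are distinct. -/
theorem distinct_prods_after_rr_divergence {Q N T : Type} (M : Table Q N T)
    {ν ν' ν'' μ₁ μ₂ : Config Q N T} {x : Option T} {R' R'' : Q}
    {p' p'' : Prod' N T} (hne : p' ≠ p'')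
    (h' : ExecL M (.reduce x R' p') ν ν')
    (h'' : ExecL M (.reduce x R'' p'') ν ν'')
    (e₁ : ExecStar M ν' μ₁) (e₂ : ExecStar M ν'' μ₂) :
    μ₁.prods ≠ μ₂.prods := by
  intro heq
  have s₁ := e₁.prods_suffix
  have s₂ := heq ▸ e₂.prods_suffix
  cases h'
  cases h''
  have h := List.suffix_or_suffix_of_suffix s₁ s₂
  have hcons := h.elim (fun t => t.eq_of_length (by simp))
    (fun t => (t.eq_of_length (by simp)).symm)
  exact hne (List.cons.inj hcons).1
end

section
/- Let S be an SR-automaton with initial state P_init and transition function τ_SR. If (ε, [P_init], ε, []) ⇒* (ε, Γ, z, Δ) for some state-stack Γ and production-stack Δ, then P_init ⇛_z top(Γ) in the labelled approximation relations of S. Consequently, the approximated structure accepts a superset of the language of the SR-automaton: for every w ∈ L(S) there is a state Q with P_init ⇛_{w$} Q. -/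
set_option autoImplicit false

namespace SR

variable {Q N T : Type}

/-- Appending a letter to a word of the approximation relations. -/
lemma DArrowWord.snoc {M : Table Q N T} {z : List (Option T)} {x : Option T} {P P' P'' : Q}
    (h : DArrowWord M z P P') (hx : DArrow M x P' P'') : DArrowWord M (z ++ [x]) P P'' := by
  induction z generalizing P with
  | nil =>
    cases h
    exact ⟨P'', hx, rfl⟩
  | cons y z ih =>
    obtain ⟨R, hy, hz⟩ := h
    exact ⟨R, hy, ih hz⟩

/-- Configurations whose top state is reached in the approximation relations from the initial
state by the word component, followed by prospective moves on the head symbol, if any. -/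
def Approximated (M : Table Q N T) (c : Config Q N T) : Prop :=
  ∃ P₀ P, c.states.head? = some P ∧ DArrowWord M c.word M.init P₀ ∧
    ((c.head = none ∧ P₀ = P) ∨
      ∃ x, c.head = some x ∧ Relation.ReflTransGen (ProspRel M x) P₀ P)

lemma Approximated.step {M : Table Q N T} {c c' : Config Q N T} (hc : Approximated M c)
    (h : Exec M c c') : Approximated M c' := by
  obtain ⟨l, h⟩ := h
  obtain ⟨P₀, P, hP, hw, hd⟩ := hc
  -- The head symbol of `c`, if any, is the symbol of the step.
  have reach : ∀ x, (c.head = none ∨ c.head = some x) →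
      Relation.ReflTransGen (ProspRel M x) P₀ P := by
    rintro x hx
    rcases hd with ⟨-, rfl⟩ | ⟨y, hy, hr⟩
    · exact .refl
    · obtain rfl : y = x := by simpa [hy] using hx
      exact hr
  cases h with
  | shift ht hh =>
    obtain rfl := Option.some.inj hP
    exact ⟨_, _, rfl, hw.snoc ⟨_, reach _ hh, ht⟩, .inl ⟨rfl, rfl⟩⟩
  | reduce ht _ _ hh =>
    obtain rfl := Option.some.inj hP
    exact ⟨_, _, rfl, hw, .inr ⟨_, rfl, (reach _ hh).tail ⟨_, _, ht⟩⟩⟩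

lemma Approximated.of_execStar {M : Table Q N T} {c : Config Q N T}
    (h : ExecStar M (initConfig M) c) : Approximated M c := by
  induction h with
  | refl => exact ⟨_, _, rfl, rfl, .inl ⟨rfl, rfl⟩⟩
  | tail _ hs ih => exact ih.step hs

end SR

open SR in
/-- If `(ε,[P_init],ε,[]) ⇒* (ε, Γ, z, Δ)` then
`P_init ⇛_z top(Γ)` in the labelled approximation relations; consequently the
approximated structure accepts a superset of `L(S)`: for every `w ∈ L(S)` there
is a state `Q'` with `P_init ⇛_{w$} Q'`. -/
theorem approximation_superset {Q N T : Type} (M : Table Q N T) :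
    (∀ (Γ : List Q) (z : List (Option T)) (Δ : List (Prod' N T)),
        ExecStar M (initConfig M) ⟨none, Γ, z, Δ⟩ →
        ∃ Qt : Q, Γ.head? = some Qt ∧ DArrowWord M z M.init Qt) ∧
    (∀ w ∈ SRLang M, ∃ Q' : Q, DArrowWord M (endWord w) M.init Q') := by
  have top_reached : ∀ (Γ : List Q) (z : List (Option T)) (Δ : List (Prod' N T)),
      ExecStar M (initConfig M) ⟨none, Γ, z, Δ⟩ →
      ∃ Qt : Q, Γ.head? = some Qt ∧ DArrowWord M z M.init Qt := by
    intro Γ z Δ h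
    obtain ⟨P₀, P, hP, hw, ⟨-, rfl⟩ | ⟨x, hx, -⟩⟩ := Approximated.of_execStar h
    · exact ⟨_, hP, hw⟩
    · cases hx
  refine ⟨top_reached, ?_⟩
  rintro w ⟨Γ, Δ, h⟩
  obtain ⟨Qt, -, hw⟩ := top_reached Γ _ Δ h
  exact ⟨Qt, hw⟩
end
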